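/- arXiv:math/0507352 — 2 statements merged into one kernel-verified Lean document; each statement's English description precedes it below -/
import Mathlib

section
/- A positive natural number N satisfies N ≤ 5 if and only if for every prime p with p ≡ 1 (mod 4) the square N² is not excluded by p. (Euler's conclusion: the only squares left behind by the exclusion procedure, hence the only square idoneal numbers, are 1, 4, 9, 16 and 25.) -/
/-- Euler's exclusion rule: a natural number `s` is *excluded by* the prime `p` if
(i) `4 * s > p ^ 2`,
(ii) there exist integers `x`, `y` with `p ∤ y` and `(s : ℤ) = p * x - y ^ 2`, and
(iii) there is no integer `y` with `(s : ℤ) = p ^ 2 - y ^ 2`. -/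
def ExcludedBy (p s : ℕ) : Prop :=
  4 * s > p ^ 2 ∧
  (∃ x y : ℤ, ¬ (p : ℤ) ∣ y ∧ (s : ℤ) = p * x - y ^ 2) ∧
  ¬ ∃ y : ℤ, (s : ℤ) = (p : ℤ) ^ 2 - y ^ 2

/-- A prime `p ≡ 1 (mod 4)` below `N` that does not divide `N` excludes `N ^ 2`. -/
theorem excludedBy_sq_of_lt_of_not_dvd {p N : ℕ} (hp : p.Prime) (hp4 : p % 4 = 1) (hlt : p < N)
    (hdvd : ¬ p ∣ N) : ExcludedBy p (N ^ 2) := by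
  have : Fact p.Prime := ⟨hp⟩
  refine ⟨by nlinarith, ?_, ?_⟩
  · obtain ⟨z, hz⟩ := ZMod.exists_sq_eq_neg_one_iff.2 (show p % 4 ≠ 3 by omega)
    obtain ⟨i, rfl⟩ := ZMod.intCast_surjective z
    have hi : (p : ℤ) ∣ i ^ 2 + 1 := by
      rw [← ZMod.intCast_zmod_eq_zero_iff_dvd _ p]
      push_cast
      rw [sq, ← hz]
      ring
    have hpZ : Prime (p : ℤ) := Nat.prime_iff_prime_int.1 hp
    obtain ⟨k, hk⟩ := hi
    refine ⟨k * (N : ℤ) ^ 2, i * N, fun h => ?_, ?_⟩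
    · rcases hpZ.dvd_or_dvd h with h | h
      · have h1 : (p : ℤ) ∣ 1 := by
          have h2 : (p : ℤ) ∣ i ^ 2 + 1 := ⟨k, hk⟩
          exact (Int.dvd_add_right (dvd_pow h two_ne_zero)).1 h2
        exact hpZ.not_dvd_one h1
      · exact hdvd (Int.natCast_dvd_natCast.1 h)
    · push_cast
      linear_combination (N : ℤ) ^ 2 * hk
  · rintro ⟨y, hy⟩
    push_cast at hy
    have : (p : ℤ) < N := by exact_mod_cast hlt
    nlinarith [sq_nonneg y, (Nat.cast_nonneg p : (0 : ℤ) ≤ p)]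

/-- A product of distinct primes that are at most `q` splits into two coprime factors whose ratio
is at most `q`. -/
theorem exists_coprime_balanced_factorization (q : ℕ) (S : Finset ℕ)
    (hS : ∀ s ∈ S, s.Prime ∧ s ≤ q) (hq : 1 ≤ q) :
    ∃ a b : ℕ, a * b = ∏ s ∈ S, s ∧ a.Coprime b ∧ b ≤ a ∧ a ≤ b * q := by
  induction S using Finset.induction_on with
  | empty => exact ⟨1, 1, by simp, by simp, le_rfl, by simpa using hq⟩
  | insert s S hs ih =>
    obtain ⟨a, b, hab, hco, hba, haq⟩ := ih fun t ht => hS t (Finset.mem_insert_of_mem ht)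
    obtain ⟨hsp, hsq⟩ := hS s (Finset.mem_insert_self s S)
    have hcop : s.Coprime (a * b) := by
      rw [hab]
      refine Nat.Coprime.prod_right fun t ht => ?_
      refine (Nat.coprime_primes hsp (hS t (Finset.mem_insert_of_mem ht)).1).2 ?_
      rintro rfl
      exact hs ht
    have hco' : a.Coprime (b * s) := hco.mul_right hcop.coprime_mul_right_right.symm
    have hprod : a * (b * s) = ∏ t ∈ insert s S, t := by
      rw [Finset.prod_insert hs, ← hab]
      ring
    rcases le_total (b * s) a with h | h
    · exact ⟨a, b * s, hprod, hco', h, haq.trans (by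
        gcongr
        exact Nat.le_mul_of_pos_right b hsp.pos)⟩
    · exact ⟨b * s, a, by rw [mul_comm, hprod], hco'.symm, h, Nat.mul_le_mul hba hsq⟩

/-- A number `N > 29` is not divisible by all the primes `p ≡ 1 (mod 4)` below it. -/
theorem exists_prime_one_mod_four_lt_not_dvd {N : ℕ} (hN : 29 < N) :
    ∃ p : ℕ, p.Prime ∧ p % 4 = 1 ∧ p < N ∧ ¬ p ∣ N := by
  by_contra! hall
  set S := (Finset.range N).filter fun p => p.Prime ∧ p % 4 = 1 with hSdef
  have hmem : ∀ {l : ℕ}, l ∈ S ↔ l < N ∧ l.Prime ∧ l % 4 = 1 := by simp [hSdef]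
  have h29 : 29 ∈ S := hmem.2 ⟨hN, by norm_num, by norm_num⟩
  obtain ⟨p, hpS, hpmax⟩ := S.exists_max_image id ⟨29, h29⟩
  have hp29 : 29 ≤ p := hpmax 29 h29
  obtain ⟨-, hp, hp4⟩ := hmem.1 hpS
  obtain ⟨a, b, hab, hco, hba, haq⟩ :=
    exists_coprime_balanced_factorization (p - 4) (S.erase p) (fun s hs => by
      obtain ⟨hne, hs⟩ := Finset.mem_erase.1 hs
      have hle : s ≤ p := hpmax s hs
      have := (hmem.1 hs).2
      exact ⟨this.1, by omega⟩) (by omega)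
  have hprod : a * b * p = ∏ s ∈ S, s := by
    rw [hab, Finset.prod_erase_mul S _ hpS]
  have hprodN : a * b * p ≤ N := by
    rw [hprod]
    refine Nat.le_of_dvd (by omega) (Finset.prod_primes_dvd N ?_ ?_)
    · exact fun s hs => (hmem.1 hs).2.1.prime
    · exact fun s hs => hall s (hmem.1 hs).2.1 (hmem.1 hs).2.2 (hmem.1 hs).1
  have hndvd : ∀ {l : ℕ}, l.Prime → l ∉ S.erase p → ¬ l ∣ a * b := by
    intro l hl hlS h
    rw [hab, hl.prime.dvd_finsetProd_iff] at h
    obtain ⟨s, hs, hls⟩ := h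
    have := (Nat.prime_dvd_prime_iff_eq hl (hmem.1 (Finset.mem_of_mem_erase hs)).2.1).1 hls
    exact hlS (this ▸ hs)
  have h2 : ¬ 2 ∣ a * b := hndvd Nat.prime_two fun h => by
    have := (hmem.1 (Finset.mem_of_mem_erase h)).2.2
    omega
  have hpab : ¬ p ∣ a * b := hndvd hp (Finset.notMem_erase p S)
  have hb : 0 < b := Nat.pos_of_ne_zero fun h => h2 (by simp [h])
  obtain ⟨t, ht, hpt⟩ : ∃ t : ℕ, (t = 2 ∨ t = 4) ∧ ¬ p ∣ a ^ 2 + (t * b) ^ 2 := by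
    by_contra! h
    have h12 : p ∣ 12 * b ^ 2 := by
      have := Nat.dvd_sub (h 4 (.inr rfl)) (h 2 (.inl rfl))
      rwa [show a ^ 2 + (4 * b) ^ 2 - (a ^ 2 + (2 * b) ^ 2) = 12 * b ^ 2 by
        rw [Nat.sub_eq_iff_eq_add (by nlinarith)]
        ring] at this
    rcases hp.dvd_mul.1 h12 with h | h
    · exact absurd (Nat.le_of_dvd (by norm_num) h) (by omega)
    · exact hpab ((hp.dvd_of_dvd_pow h).mul_left a)
  have ha2 : a.Coprime 2 :=
    (Nat.coprime_comm.1 ((Nat.prime_two.coprime_iff_not_dvd).2 fun h => h2 (h.mul_right b)))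
  have hat : a.Coprime t := by
    rcases ht with rfl | rfl
    · exact ha2
    · exact ha2.pow_right 2
  have hcop : a.Coprime (t * b) := hat.mul_right hco
  have hlt : a ^ 2 + (t * b) ^ 2 < N := by
    refine lt_of_lt_of_le ?_ hprodN
    have ht4 : (t * b) ^ 2 ≤ (4 * b) ^ 2 := by
      gcongr
      omega
    refine lt_of_le_of_lt (Nat.add_le_add_left ht4 _) ?_
    obtain ⟨q, rfl⟩ : ∃ q, p = q + 4 := ⟨p - 4, by omega⟩
    rw [Nat.add_sub_cancel] at haq
    have hq : 25 ≤ q := by omega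
    zify at *
    nlinarith [mul_nonneg (sub_nonneg.2 hba) (sub_nonneg.2 haq), mul_pos hb hb,
      mul_nonneg (sub_nonneg.2 hq) (mul_pos hb hb).le, mul_nonneg hb.le (sub_nonneg.2 hba)]
  have hne1 : a ^ 2 + (t * b) ^ 2 ≠ 1 := by
    have : 0 < a ^ 2 := pow_pos (hb.trans_le hba) 2
    have : 0 < (t * b) ^ 2 := by
      have : 0 < t := by omega
      positivity
    omega
  obtain ⟨l, hl, hlc⟩ := Nat.exists_prime_and_dvd hne1
  have hlN : l < N :=
    (Nat.le_of_dvd (Nat.pos_of_ne_zero fun h => hpt (by simp [h])) hlc).trans_lt hlt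
  have hltb : ¬ l ∣ t * b := fun h => by
    have hla : l ∣ a := hl.dvd_of_dvd_pow
      ((Nat.dvd_add_left (dvd_pow h two_ne_zero)).1 hlc)
    exact Nat.not_coprime_of_dvd_of_dvd hl.one_lt hla h hcop
  have hla : ¬ l ∣ a := fun h => hltb (hl.dvd_of_dvd_pow
    ((Nat.dvd_add_right (dvd_pow h two_ne_zero)).1 hlc))
  have hl2 : l ≠ 2 := by
    rintro rfl
    exact hltb (Dvd.dvd.mul_right (by omega) b)
  have hl3 : l % 4 ≠ 3 := by
    have hc0 : a ^ 2 + (t * b) ^ 2 ≠ 0 := fun h => hpt (by simp [h])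
    exact Nat.mod_four_ne_three_of_mem_primeFactors_of_isSquare_neg_one
      (Nat.mem_primeFactors.2 ⟨hl, hlc, hc0⟩)
      (ZMod.isSquare_neg_one_of_eq_sq_add_sq_of_coprime rfl hcop)
  have hl4 : l % 4 = 1 := by
    have := hl.eq_two_or_odd
    omega
  have hlS : l ∈ S.erase p :=
    Finset.mem_erase.2 ⟨fun h => hpt (h ▸ hlc), hmem.2 ⟨hlN, hl, hl4⟩⟩
  rcases hl.dvd_mul.1 (hab ▸ Finset.dvd_prod_of_mem (fun s => s) hlS : l ∣ a * b) with h | h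
  · exact hla h
  · exact hltb (h.mul_left t)

theorem euler_square_survives_iff_le_five (N : ℕ) (hN : 0 < N) :
    N ≤ 5 ↔ ∀ p : ℕ, p.Prime → p % 4 = 1 → ¬ ExcludedBy p (N ^ 2) := by
  constructor
  · rintro hN5 p hp hp4 ⟨hlt, -, hno⟩
    have hp10 : p < 2 * N := by nlinarith
    have hp1 := hp.one_lt
    have hp9 : p ≠ 9 := by
      rintro rfl
      norm_num at hp
    obtain rfl : p = 5 := by omega
    obtain rfl | rfl | rfl : N = 3 ∨ N = 4 ∨ N = 5 := by omega
    · exact hno ⟨4, by norm_num⟩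
    · exact hno ⟨3, by norm_num⟩
    · exact hno ⟨0, by norm_num⟩
  · intro h
    by_contra! hN5
    have hdvd : ∀ p : ℕ, p.Prime → p % 4 = 1 → p < N → p ∣ N := fun p hp hp4 hlt => by
      by_contra hn
      exact h p hp hp4 (excludedBy_sq_of_lt_of_not_dvd hp hp4 hlt hn)
    have h5 := hdvd 5 (by norm_num) (by norm_num) hN5
    by_cases h13 : 13 < N
    · have h13 := hdvd 13 (by norm_num) (by norm_num) h13
      obtain ⟨p, hp, hp4, hlt, hn⟩ :=
        exists_prime_one_mod_four_lt_not_dvd (N := N) (by omega)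
      exact hn (hdvd p hp hp4 hlt)
    · obtain rfl : N = 10 := by omega
      refine h 13 (by norm_num) (by norm_num) ⟨by norm_num, ⟨8, 2, by norm_num, by norm_num⟩, ?_⟩
      rintro ⟨y, hy⟩
      push_cast at hy
      have h1 : y < 9 := by nlinarith
      have h2 : -9 < y := by nlinarith
      interval_cases y <;> norm_num at hy
end

section
/- Let N be a natural number with N ≥ 6. If N² is excluded by none of the primes 5, 13, 17 and 29, then 32045 = 5·13·17·29 divides N. (After these four exclusions, the smallest root of a surviving square beyond 25 is 32045.) -/
/-- If `-1` is a square modulo the prime `p`, then a square `N ^ 2` that is large enough, not of the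
form `p ^ 2 - y ^ 2`, and not excluded by `p` has a root divisible by `p`. -/
theorem dvd_of_not_excludedBy_sq {p N c k : ℕ} (hp : p.Prime) (hc : c ^ 2 + 1 = p * k)
    (hpN : p < 2 * N) (hrep : ¬ ∃ y : ℤ, ((N ^ 2 : ℕ) : ℤ) = (p : ℤ) ^ 2 - y ^ 2)
    (h : ¬ ExcludedBy p (N ^ 2)) : p ∣ N := by
  by_contra hdvd
  refine h ⟨by nlinarith, ⟨k * N ^ 2, c * N, ?_, ?_⟩, hrep⟩
  · intro hcN
    have hcN : p ∣ c * N := by exact_mod_cast hcN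
    rcases hp.dvd_mul.mp hcN with hpc | hpN'
    · have hp1 : p ∣ 1 :=
        (Nat.dvd_add_right (hpc.trans (dvd_pow_self c two_ne_zero))).mp ⟨k, hc⟩
      exact hp.one_lt.ne' (Nat.dvd_one.mp hp1)
    · exact hdvd hpN'
  · have hc' : (c : ℤ) ^ 2 + 1 = p * k := by exact_mod_cast hc
    push_cast
    linear_combination (N : ℤ) ^ 2 * hc'

theorem not_exists_sq_eq_sq_sub_sq_of_lt {p N : ℕ} (hpN : p < N) :
    ¬ ∃ y : ℤ, ((N ^ 2 : ℕ) : ℤ) = (p : ℤ) ^ 2 - y ^ 2 := by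
  rintro ⟨y, hy⟩
  push_cast at hy
  have hlt : (p : ℤ) < N := by exact_mod_cast hpN
  nlinarith [sq_nonneg y]

theorem thirtytwothousand_dvd_of_not_excluded (N : ℕ) (hN : 6 ≤ N)
    (h5 : ¬ ExcludedBy 5 (N ^ 2)) (h13 : ¬ ExcludedBy 13 (N ^ 2))
    (h17 : ¬ ExcludedBy 17 (N ^ 2)) (h29 : ¬ ExcludedBy 29 (N ^ 2)) :
    32045 ∣ N := by
  have d5 : 5 ∣ N := dvd_of_not_excludedBy_sq (c := 2) (k := 1) (by norm_num) (by norm_num)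
    (by lia) (not_exists_sq_eq_sq_sub_sq_of_lt (by lia)) h5
  have d13 : 13 ∣ N := by
    refine dvd_of_not_excludedBy_sq (c := 5) (k := 2) (by norm_num) (by norm_num) (by lia) ?_ h13
    obtain hlt | hle := lt_or_ge 13 N
    · exact not_exists_sq_eq_sq_sub_sq_of_lt hlt
    · obtain rfl : N = 10 := by lia
      rintro ⟨y, hy⟩
      push_cast at hy
      have hy1 : y < 9 := by nlinarith
      have hy2 : -9 < y := by nlinarith
      interval_cases y <;> lia
  have d17 : 17 ∣ N := dvd_of_not_excludedBy_sq (c := 4) (k := 1) (by norm_num) (by norm_num)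
    (by lia) (not_exists_sq_eq_sq_sub_sq_of_lt (by lia)) h17
  have d29 : 29 ∣ N := dvd_of_not_excludedBy_sq (c := 12) (k := 5) (by norm_num) (by norm_num)
    (by lia) (not_exists_sq_eq_sq_sub_sq_of_lt (by lia)) h29
  have d65 : 5 * 13 ∣ N := Nat.Coprime.mul_dvd_of_dvd_of_dvd (by norm_num) d5 d13
  have d493 : 17 * 29 ∣ N := Nat.Coprime.mul_dvd_of_dvd_of_dvd (by norm_num) d17 d29
  exact Nat.Coprime.mul_dvd_of_dvd_of_dvd (m := 5 * 13) (n := 17 * 29) (by norm_num) d65 d493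
end
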